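/- Let α ∈ ℝ, s > 1/2, and let u ∈ C^∞(ℝ; H^s₊(S¹)) solve the α-Szegő equation i∂ₜu = Π(|u|²u) + α(u|1). Then with B_u := (i/2)H_u² − i T_{|u|²} one has d/dt H_{u(t)} = [B_{u(t)}, H_{u(t)}] − i α (u(t)|1) H_1, where H_1 denotes the Hankel operator of the constant function 1, i.e. H_1(h) = Π(conj(h)). -/

import Mathlib

open Complex Filter
open scoped ComplexConjugate Topology ENNReal

noncomputable section

/-- ℓ²(ℕ, ℂ): the sequence model of the Hardy space L²₊(S¹), identifying a function
with its sequence of nonnegative Fourier coefficients. -/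
abbrev Hardy : Type := lp (fun _ : ℕ => ℂ) 2

/-- A coefficient sequence belongs to L²₊. -/
def MemL2 (u : ℕ → ℂ) : Prop := Memℓp u 2

/-- A coefficient sequence belongs to the Sobolev space H^s₊. -/
def MemHs (s : ℝ) (u : ℕ → ℂ) : Prop :=
  Summable fun n : ℕ => ((1 : ℝ) + (n : ℝ) ^ 2) ^ s * ‖u n‖ ^ 2

/-- The squared H^s norm of a coefficient sequence. -/
def hsNormSq (s : ℝ) (u : ℕ → ℂ) : ℝ :=
  ∑' n : ℕ, ((1 : ℝ) + (n : ℝ) ^ 2) ^ s * ‖u n‖ ^ 2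

/-- The L² inner product (f|g), ℂ-linear in the first argument. -/
def hinner (f g : ℕ → ℂ) : ℂ := ∑' n : ℕ, f n * conj (g n)

/-- The squared L² norm. -/
def l2normSq (f : ℕ → ℂ) : ℝ := ∑' n : ℕ, ‖f n‖ ^ 2

/-- Coefficients of the constant function 1. -/
def oneSeq : ℕ → ℂ := fun n => if n = 0 then 1 else 0

/-- The Hankel operator H_u(h) = Π(u ⬝ conj h) in Fourier coefficients. -/
def hankel (u h : ℕ → ℂ) : ℕ → ℂ := fun k => ∑' ℓ : ℕ, u (k + ℓ) * conj (h ℓ)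

/-- The shifted Hankel operator K_u = T_z^* ∘ H_u in Fourier coefficients. -/
def khankel (u h : ℕ → ℂ) : ℕ → ℂ := fun k => ∑' ℓ : ℕ, u (k + 1 + ℓ) * conj (h ℓ)

/-- H_u². -/
def hu2 (u h : ℕ → ℂ) : ℕ → ℂ := hankel u (hankel u h)

/-- K_u². -/
def ku2 (u h : ℕ → ℂ) : ℕ → ℂ := khankel u (khankel u h)

/-- The m-th Fourier coefficient of |u|², m ∈ ℤ. -/
def absSqCoeff (u : ℕ → ℂ) (m : ℤ) : ℂ :=
  ∑' q : ℕ × ℕ, if ((q.1 : ℤ) - (q.2 : ℤ) = m) then u q.1 * conj (u q.2) else 0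

/-- The Toeplitz operator T_{|u|²} in Fourier coefficients. -/
def toeplitzAbsSq (u h : ℕ → ℂ) : ℕ → ℂ :=
  fun k => ∑' ℓ : ℕ, absSqCoeff u ((k : ℤ) - (ℓ : ℤ)) * h ℓ

/-- Fourier coefficients of Π(|u|²u). -/
def cubic (u : ℕ → ℂ) : ℕ → ℂ := fun n =>
  ∑' q : ℕ × ℕ × ℕ, if q.1 + q.2.2 = q.2.1 + n then u q.1 * conj (u q.2.1) * u q.2.2 else 0

/-- `u : ℝ → (ℕ → ℂ)` solves the α-Szegő equation i ∂ₜ u = Π(|u|²u) + α(u|1),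
written coefficientwise on nonnegative Fourier modes. -/
def SolvesSzego (α : ℝ) (u : ℝ → ℕ → ℂ) : Prop :=
  ∀ n t, HasDerivAt (fun τ => u τ n)
    (-Complex.I * (cubic (u t) n + (α : ℂ) * u t 0 * oneSeq n)) t

/-- `u` is a smooth curve valued in H^s₊. -/
def SmoothHsCurve (s : ℝ) (u : ℝ → ℕ → ℂ) : Prop :=
  (∀ t, MemHs s (u t)) ∧ ∀ n, ContDiff ℝ (⊤ : ℕ∞) fun t => u t n

/-- `u` is a continuous curve valued in H^s₊. -/
def ContHsCurve (s : ℝ) (u : ℝ → ℕ → ℂ) : Prop :=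
  (∀ t, MemHs s (u t)) ∧
    ∀ t₀ : ℝ, Tendsto (fun t => hsNormSq s (fun n => u t n - u t₀ n)) (𝓝 t₀) (𝓝 0)

/-- E_u(τ) = ker(H_u² − τ² I) as a subset of ℓ². -/
def Espace (u : ℕ → ℂ) (τ : ℝ) : Set (ℕ → ℂ) :=
  {h | MemL2 h ∧ hu2 u h = ((τ : ℂ) ^ 2) • h}

/-- F_u(τ) = ker(K_u² − τ² I) as a subset of ℓ². -/
def Fspace (u : ℕ → ℂ) (τ : ℝ) : Set (ℕ → ℂ) :=
  {h | MemL2 h ∧ ku2 u h = ((τ : ℂ) ^ 2) • h}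

/-- Σ_H(u): τ > 0 such that E_u(τ) is not orthogonal to u. -/
def SigmaH (u : ℕ → ℂ) : Set ℝ :=
  {τ : ℝ | 0 < τ ∧ ∃ v ∈ Espace u τ, hinner u v ≠ 0}

/-- Σ_K(u): τ ≥ 0 such that F_u(τ) is not orthogonal to u. -/
def SigmaK (u : ℕ → ℂ) : Set ℝ :=
  {τ : ℝ | 0 ≤ τ ∧ ∃ v ∈ Fspace u τ, hinner u v ≠ 0}

/-- `p` is the orthogonal projection of `w` on the subspace `V` of ℓ². -/
def IsOrthProj (V : Set (ℕ → ℂ)) (w p : ℕ → ℂ) : Prop :=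
  p ∈ V ∧ ∀ v ∈ V, hinner (w - p) v = 0

/-- The rank of the shifted Hankel operator K_u. -/
def kuRank (u : ℕ → ℂ) : Cardinal :=
  Module.rank ℂ (Submodule.span ℂ (khankel u '' {h | MemL2 h}))

/-- The rank of the Hankel operator H_u. -/
def huRank (u : ℕ → ℂ) : Cardinal :=
  Module.rank ℂ (Submodule.span ℂ (hankel u '' {h | MemL2 h}))

/-- ℒ(N) : rank K_u = N. -/
def InLN (N : ℕ) (u : ℕ → ℂ) : Prop := MemL2 u ∧ kuRank u = N

/-- The constant function 1 as an element of ℓ². -/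
def oneH : Hardy := lp.single 2 0 1


/-- The operator B_u = (i/2) H_u² − i T_{|u|²}. -/
def Bop (u h : ℕ → ℂ) : ℕ → ℂ := fun k =>
  Complex.I / 2 * hu2 u h k - Complex.I * toeplitzAbsSq u h k

/-- A pointwise limit of differentiable functions is constant if it dominates them and their
derivatives tend to zero uniformly on every set where the limit is bounded. -/
theorem const_of_deriv_le_of_tendsto {N Φ : ℝ → ℝ} {f : ℕ → ℝ → ℝ} {ε : ℕ → ℝ}
    (hε : Tendsto ε atTop (𝓝 0)) (hε0 : ∀ m, 0 ≤ ε m) (hΦ : Monotone Φ)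
    (hf : ∀ m, Differentiable ℝ (f m)) (hle : ∀ m t, f m t ≤ N t)
    (hlim : ∀ t, Tendsto (fun m => f m t) atTop (𝓝 (N t)))
    (hd : ∀ m t, |deriv (f m) t| ≤ ε m * Φ (N t)) (a b : ℝ) : N a = N b := by
  have key : ∀ c d C : ℝ, c < d → (∀ t ∈ Set.Ioo c d, N t ≤ C) → N c = N d := by
    intro c d C hcd hC
    have hz : Tendsto (fun m => f m d - f m c) atTop (𝓝 0) := by
      refine squeeze_zero_norm (a := fun m => ε m * Φ C * (d - c)) (fun m => ?_) ?_
      · obtain ⟨ξ, hξ, hs⟩ := exists_deriv_eq_slope (f m) hcd (hf m).continuous.continuousOn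
          (hf m).differentiableOn
        have hpos : 0 < d - c := sub_pos.2 hcd
        have h1 : f m d - f m c = deriv (f m) ξ * (d - c) := by rw [hs]; field_simp
        rw [h1, norm_mul, Real.norm_eq_abs, Real.norm_eq_abs, abs_of_pos hpos]
        gcongr
        exact (hd m ξ).trans (mul_le_mul_of_nonneg_left (hΦ (hC ξ hξ)) (hε0 m))
      · simpa using (hε.mul_const (Φ C)).mul_const (d - c)
    have := tendsto_nhds_unique hz ((hlim d).sub (hlim c))
    linarith
  have hcl : ∀ C : ℝ, IsClosed {t | N t ≤ C} := by
    intro C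
    have : {t | N t ≤ C} = ⋂ m, {t | f m t ≤ C} := by
      ext t
      simp only [Set.mem_ofPred_eq, Set.mem_iInter]
      exact ⟨fun h m => (hle m t).trans h, fun h => le_of_tendsto' (hlim t) h⟩
    rw [this]
    exact isClosed_iInter fun m => isClosed_le (hf m).continuous continuous_const
  let G : Set ℝ := {t | ∃ C, ∀ᶠ τ in 𝓝 t, N τ ≤ C}
  have hGo : IsOpen G := by
    rw [isOpen_iff_mem_nhds]
    rintro t ⟨C, hC⟩
    filter_upwards [hC.eventually_nhds] with τ hτ using ⟨C, hτ⟩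
  have hIcc : ∀ c d : ℝ, c < d → Set.Icc c d ⊆ G → N c = N d := by
    intro c d hcd hsub
    have hbdd : ∃ C, ∀ t ∈ Set.Icc c d, N t ≤ C := by
      refine isCompact_Icc.induction_on (p := fun s => ∃ C, ∀ t ∈ s, N t ≤ C)
        ⟨0, by simp⟩ ?_ ?_ ?_
      · rintro s t hst ⟨C, hC⟩
        exact ⟨C, fun x hx => hC x (hst hx)⟩
      · rintro s t ⟨C, hC⟩ ⟨C', hC'⟩
        refine ⟨max C C', fun x hx => ?_⟩
        rcases hx with hx | hx
        · exact (hC x hx).trans (le_max_left _ _)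
        · exact (hC' x hx).trans (le_max_right _ _)
      · intro x hx
        obtain ⟨C, hC⟩ := hsub hx
        exact ⟨{τ | N τ ≤ C}, mem_nhdsWithin_of_mem_nhds hC, C, fun t ht => ht⟩
    obtain ⟨C, hC⟩ := hbdd
    exact key c d C hcd fun t ht => hC t (Set.Ioo_subset_Icc_self ht)
  have hIoo : ∀ c d : ℝ, c < d → Set.Ioo c d ⊆ G → N c = N d := by
    intro c d hcd hsub
    have hconst : ∀ x ∈ Set.Ioo c d, ∀ y ∈ Set.Ioo c d, N x = N y := by
      intro x hx y hy
      rcases lt_trichotomy x y with h | h | h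
      · exact hIcc x y h fun z hz => hsub ⟨hx.1.trans_le hz.1, hz.2.trans_lt hy.2⟩
      · rw [h]
      · exact (hIcc y x h fun z hz => hsub ⟨hy.1.trans_le hz.1, hz.2.trans_lt hx.2⟩).symm
    have hmid : (c + d) / 2 ∈ Set.Ioo c d := ⟨by linarith, by linarith⟩
    exact key c d _ hcd fun t ht => (hconst t ht _ hmid).le
  have hG : ∀ t, t ∈ G := by
    by_contra! hne
    obtain ⟨x₀, hx₀⟩ := hne
    have hE : IsClosed Gᶜ := hGo.isClosed_compl
    have : CompleteSpace (Gᶜ : Set ℝ) := hE.completeSpace_coe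
    have : Nonempty (Gᶜ : Set ℝ) := ⟨⟨x₀, hx₀⟩⟩
    obtain ⟨n, ⟨t₀, ht₀⟩, hmem⟩ := nonempty_interior_of_iUnion_of_closed
      (f := fun n : ℕ => {t : (Gᶜ : Set ℝ) | N t ≤ n})
      (fun n => (hcl n).preimage continuous_subtype_val)
      (Set.eq_univ_of_forall fun t => Set.mem_iUnion.2 (exists_nat_ge (N t)))
    obtain ⟨δ, hδ, hball⟩ := Metric.mem_nhds_iff.1 (mem_interior_iff_mem_nhds.1 hmem)
    have hEn : ∀ t, t ∉ G → |t - t₀| < δ → N t ≤ n := fun t ht hlt =>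
      hball (show (⟨t, ht⟩ : (Gᶜ : Set ℝ)) ∈ Metric.ball _ δ by
        rw [Metric.mem_ball, Subtype.dist_eq, Real.dist_eq]; exact hlt)
    refine ht₀ ⟨n, ?_⟩
    filter_upwards [Metric.ball_mem_nhds t₀ hδ] with t ht
    rw [Metric.mem_ball, Real.dist_eq] at ht
    by_cases htG : t ∈ G
    swap
    · exact hEn t htG ht
    rcases lt_trichotomy t t₀ with hlt | heq | hgt
    · have hne : (Gᶜ ∩ Set.Icc t t₀).Nonempty := ⟨t₀, ht₀, hlt.le, le_rfl⟩
      have hbb : BddBelow (Gᶜ ∩ Set.Icc t t₀) := ⟨t, fun x hx => hx.2.1⟩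
      have hmem := (hE.inter isClosed_Icc).csInf_mem hne hbb
      set e := sInf (Gᶜ ∩ Set.Icc t t₀) with he
      have hte : t < e := lt_of_le_of_ne hmem.2.1 fun h => hmem.1 (h ▸ htG)
      rw [hIoo t e hte fun x hx => by
        by_contra hxG
        exact absurd (csInf_le hbb ⟨hxG, hx.1.le, hx.2.le.trans hmem.2.2⟩) (not_le.2 hx.2)]
      refine hEn e hmem.1 ?_
      rw [abs_lt] at ht ⊢
      constructor <;> linarith [hmem.2.2]
    · exact absurd (heq ▸ htG) ht₀
    · have hne : (Gᶜ ∩ Set.Icc t₀ t).Nonempty := ⟨t₀, ht₀, le_rfl, hgt.le⟩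
      have hbb : BddAbove (Gᶜ ∩ Set.Icc t₀ t) := ⟨t, fun x hx => hx.2.2⟩
      have hmem := (hE.inter isClosed_Icc).csSup_mem hne hbb
      set e := sSup (Gᶜ ∩ Set.Icc t₀ t) with he
      have hte : e < t := lt_of_le_of_ne hmem.2.2 fun h => hmem.1 (h ▸ htG)
      rw [← hIoo e t hte fun x hx => by
        by_contra hxG
        exact absurd (le_csSup hbb ⟨hxG, hmem.2.1.trans hx.1.le, hx.2.le⟩) (not_le.2 hx.1)]
      refine hEn e hmem.1 ?_
      rw [abs_lt] at ht ⊢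
      constructor <;> linarith [hmem.2.1]
  rcases lt_trichotomy a b with h | h | h
  · exact hIcc a b h fun t _ => hG t
  · rw [h]
  · exact (hIcc b a h fun t _ => hG t).symm

/-- The identity damped logarithmically, so that it vanishes from `exp L` on. -/
def logCutoff (L x : ℝ) : ℝ := x - x * min (Real.log x) L / L

theorem logCutoff_nonneg {L x : ℝ} (hL : 0 < L) (hx : 0 ≤ x) : 0 ≤ logCutoff L x := by
  unfold logCutoff
  have h : x * min (Real.log x) L / L ≤ x * L / L := by
    gcongr
    exact min_le_right _ _
  rw [mul_div_cancel_right₀ x hL.ne'] at h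
  linarith

theorem logCutoff_le {L x : ℝ} (hL : 0 < L) (hx : 1 ≤ x) : logCutoff L x ≤ x := by
  unfold logCutoff
  have : 0 ≤ min (Real.log x) L := le_min (Real.log_nonneg hx) hL.le
  have : 0 ≤ x * min (Real.log x) L / L := by positivity
  linarith

theorem logCutoff_eq_zero {L x : ℝ} (hL : 0 < L) (hx : Real.exp L ≤ x) : logCutoff L x = 0 := by
  unfold logCutoff
  have h0 : 0 < x := (Real.exp_pos L).trans_le hx
  rw [min_eq_right ((Real.le_log_iff_exp_le h0).2 hx)]
  field_simp
  ring

theorem tendsto_logCutoff {x : ℝ} (hx : 1 ≤ x) :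
    Tendsto (fun L => logCutoff L x) atTop (𝓝 x) := by
  have h : Tendsto (fun L : ℝ => x - x * Real.log x / L) atTop (𝓝 (x - 0)) :=
    tendsto_const_nhds.sub (tendsto_const_nhds.div_atTop tendsto_id)
  rw [sub_zero] at h
  refine tendsto_of_tendsto_of_tendsto_of_le_of_le' h tendsto_const_nhds ?_ ?_
  · filter_upwards [eventually_gt_atTop 0] with L hL
    unfold logCutoff
    gcongr
    exact min_le_left _ _
  · filter_upwards [eventually_gt_atTop 0] with L hL using logCutoff_le hL hx

theorem abs_logCutoff_second_difference_le {L p q r n : ℝ} (hL : 0 < L) (hp : 1 ≤ p) (hq : 1 ≤ q)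
    (hr : 1 ≤ r) (hpn : p ≤ n) (hrn : r ≤ n) (h : p + r = q + n) :
    |logCutoff L p + logCutoff L r - logCutoff L q - logCutoff L n|
      ≤ 8 / L * (√p * √r) := by
  wlog hrp : r ≤ p generalizing p r with H
  · have := H hr hp hrn hpn (by linarith) (le_of_not_ge hrp)
    rw [mul_comm √p, add_comm (logCutoff L p)]
    exact this
  have hn : 0 < n := by linarith
  set g : ℝ → ℝ := fun x => min (Real.log n) L - min (Real.log x) L with hg
  have hg0 : ∀ x, 1 ≤ x → x ≤ n → 0 ≤ g x := fun x h1 h2 =>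
    sub_nonneg.2 (min_le_min_right _ (Real.log_le_log (by linarith) h2))
  have hg1 : ∀ x, 1 ≤ x → x ≤ n → g x ≤ Real.log (n / x) := by
    intro x h1 h2
    have hl : Real.log x ≤ Real.log n := Real.log_le_log (by linarith) h2
    rw [Real.log_div hn.ne' (by linarith)]
    simp only [hg]
    rcases le_total (Real.log n) L with h3 | h3 <;> rcases le_total (Real.log x) L with h4 | h4 <;>
      simp only [min_eq_left, min_eq_right, h3, h4] <;> linarith
  have hsq : ∀ x, 1 ≤ x → x ≤ n → x * g x ≤ 2 * (√x * √n) := by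
    intro x h1 h2
    have hx : 0 < x := by linarith
    have h3 : Real.log (n / x) ≤ 2 * (√n / √x) := by
      have h4 : Real.log (n / x) = 2 * Real.log (√(n / x)) := by
        rw [Real.log_sqrt (by positivity)]; ring
      rw [h4, ← Real.sqrt_div' _ hx.le]
      have := Real.log_le_sub_one_of_pos (Real.sqrt_pos.2 (div_pos hn hx))
      linarith
    calc x * g x ≤ x * (2 * (√n / √x)) := by
          gcongr
          exact (hg1 x h1 h2).trans h3
      _ = 2 * (√x * √n) := by
          have h5 : √x ≠ 0 := (Real.sqrt_pos.2 hx).ne'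
          have h6 : √x * √x = x := Real.mul_self_sqrt hx.le
          field_simp
          rw [sq, h6]
  have hqr : q ≤ r := by linarith
  have hpp : p * g p ≤ r := by
    have h3 := hg1 p hp hpn
    have h4 := Real.log_le_sub_one_of_pos (div_pos hn (by linarith : 0 < p))
    calc p * g p ≤ p * (n / p - 1) := by gcongr; linarith
      _ = n - p := by field_simp
      _ ≤ r := by linarith
  have hrr : r ≤ √r * √n := by
    rw [← Real.sqrt_mul (by linarith)]
    exact Real.le_sqrt_of_sq_le (by nlinarith)
  have hqq : √q * √n ≤ √r * √n := by gcongr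
  have hnp : √r * √n ≤ 2 * (√p * √r) := by
    have : √n ≤ 2 * √p := by
      rw [Real.sqrt_le_left (by positivity), mul_pow, Real.sq_sqrt (by linarith)]
      linarith
    nlinarith [Real.sqrt_nonneg r]
  have hid : logCutoff L p + logCutoff L r - logCutoff L q - logCutoff L n
      = (p * g p + r * g r - q * g q) / L := by
    simp only [logCutoff, hg]
    field_simp
    have : n = p + r - q := by linarith
    rw [this]
    ring
  rw [hid, abs_div, abs_of_pos hL, div_mul_eq_mul_div]
  gcongr
  have h1 := hsq q hq (by linarith)
  have h2 := hsq r hr hrn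
  have h3 := mul_nonneg (by linarith : (0:ℝ) ≤ p) (hg0 p hp hpn)
  have h4 := mul_nonneg (by linarith : (0:ℝ) ≤ q) (hg0 q hq (by linarith))
  have h5 := mul_nonneg (by linarith : (0:ℝ) ≤ r) (hg0 r hr hrn)
  rw [abs_le]
  constructor <;> linarith

theorem ENNReal.mul_le_sq_add_sq (x y : ℝ≥0∞) : x * y ≤ x ^ 2 + y ^ 2 := by
  rcases le_total x y with h | h
  · calc x * y ≤ y * y := by gcongr
      _ ≤ x ^ 2 + y ^ 2 := by rw [sq y]; exact le_add_self
  · calc x * y ≤ x * x := by gcongr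
      _ ≤ x ^ 2 + y ^ 2 := by rw [sq x]; exact le_self_add

theorem ENNReal.tsum_ite_le_of_unique {ι : Type*} (P : ι → Prop) [DecidablePred P] (c : ℝ≥0∞)
    (h : ∀ i j, P i → P j → i = j) : ∑' i, (if P i then c else 0) ≤ c := by
  by_cases hP : ∃ i, P i
  · obtain ⟨i, hi⟩ := hP
    rw [tsum_eq_single i fun j hj => if_neg fun hPj => hj (h j i hPj hi), if_pos hi]
  · push Not at hP
    simp [hP]

/-- A quadrilinear resonant sum in which `n` is the largest index. -/
theorem ENNReal.tsum_resonant_le (A D : ℕ → ℝ≥0∞) (J : ℕ) :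
    ∑' x : ℕ × ℕ × ℕ × ℕ,
      (if x.1 + x.2.1 = x.2.2.2 + x.2.2.1 ∧ x.1 ≤ x.2.2.1 ∧ x.2.1 ≤ x.2.2.1 ∧ x.2.2.2 < J
        then D x.1 * D x.2.1 * A x.2.2.1 * A x.2.2.2 else 0)
      ≤ (∑ q ∈ Finset.range J, A q) *
        ((∑' p, D p ^ 2) ^ 2 + ∑' n : ℕ, ((n : ℝ≥0∞) + 1) * A n ^ 2) := by
  set e : ℕ × ℕ × ℕ × ℕ ≃ ℕ × ℕ × ℕ × ℕ :=
    { toFun := fun y => (y.2.2.1, y.2.2.2, y.2.1, y.1)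
      invFun := fun x => (x.2.2.2, x.2.2.1, x.1, x.2.1)
      left_inv := fun _ => rfl
      right_inv := fun _ => rfl } with he
  have hinner : ∀ q, ∑' n, ∑' p, ∑' r, (if p + r = q + n ∧ p ≤ n then D p * D r * A n else 0)
      ≤ (∑' p, D p ^ 2) ^ 2 + ∑' n : ℕ, ((n : ℝ≥0∞) + 1) * A n ^ 2 := by
    intro q
    calc ∑' n, ∑' p, ∑' r, (if p + r = q + n ∧ p ≤ n then D p * D r * A n else 0)
        ≤ ∑' n, ∑' p, ∑' r, ((if p + r = q + n then D p ^ 2 * D r ^ 2 else 0)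
            + if p + r = q + n then (if p ≤ n then A n ^ 2 else 0) else 0) := by
          gcongr with n p r
          by_cases h1 : p + r = q + n <;> by_cases h2 : p ≤ n <;> simp only [h1, h2,
            false_and, and_false, and_self, if_true, if_false, zero_le]
          rw [← mul_pow]
          exact ENNReal.mul_le_sq_add_sq _ _
      _ = ∑' n, ∑' p, ∑' r, (if p + r = q + n then D p ^ 2 * D r ^ 2 else 0)
          + ∑' n, ∑' p, ∑' r, (if p + r = q + n then (if p ≤ n then A n ^ 2 else 0) else 0) := by
          simp only [ENNReal.tsum_add]
      _ ≤ _ := by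
          refine add_le_add ?_ (ENNReal.tsum_le_tsum fun n => ?_)
          · calc ∑' n, ∑' p, ∑' r, (if p + r = q + n then D p ^ 2 * D r ^ 2 else 0)
                = ∑' p, ∑' r, ∑' n, (if p + r = q + n then D p ^ 2 * D r ^ 2 else 0) := by
                  rw [ENNReal.tsum_comm]
                  exact tsum_congr fun p => ENNReal.tsum_comm
              _ ≤ ∑' p, ∑' r, D p ^ 2 * D r ^ 2 := by
                  gcongr with p r
                  exact ENNReal.tsum_ite_le_of_unique _ _ fun i j hi hj => by omega
              _ = (∑' p, D p ^ 2) ^ 2 := by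
                  simp only [ENNReal.tsum_mul_left, ENNReal.tsum_mul_right, sq]
          · calc ∑' p, ∑' r, (if p + r = q + n then (if p ≤ n then A n ^ 2 else 0) else 0)
                ≤ ∑' p, (if p ≤ n then A n ^ 2 else 0) := by
                  gcongr with p
                  exact ENNReal.tsum_ite_le_of_unique _ _ fun i j hi hj => by omega
              _ = ∑ p ∈ Finset.range (n + 1), A n ^ 2 := by
                  rw [tsum_eq_sum (s := Finset.range (n + 1)) fun p hp => if_neg fun h =>
                    hp (Finset.mem_range.2 (by omega))]
                  exact Finset.sum_congr rfl fun p hp =>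
                    if_pos (Nat.lt_succ_iff.1 (Finset.mem_range.1 hp))
              _ = ((n : ℝ≥0∞) + 1) * A n ^ 2 := by simp
  rw [← e.tsum_eq]
  calc _ ≤ ∑' q, ∑' n, ∑' p, ∑' r, (if q < J then A q else 0) *
        (if p + r = q + n ∧ p ≤ n then D p * D r * A n else 0) := by
        rw [ENNReal.tsum_prod']
        gcongr with q
        rw [ENNReal.tsum_prod']
        gcongr with n
        rw [ENNReal.tsum_prod']
        gcongr with p r
        simp only [he, Equiv.coe_fn_mk]
        split_ifs with h1 h2 h3
        · rw [mul_comm]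
        all_goals first | exact zero_le | (exfalso; tauto)
    _ = ∑' q, (if q < J then A q else 0) *
        ∑' n, ∑' p, ∑' r, (if p + r = q + n ∧ p ≤ n then D p * D r * A n else 0) := by
        simp only [ENNReal.tsum_mul_left]
    _ ≤ ∑' q, (if q < J then A q else 0) *
        ((∑' p, D p ^ 2) ^ 2 + ∑' n : ℕ, ((n : ℝ≥0∞) + 1) * A n ^ 2) := by
        gcongr with q
        exact hinner q
    _ = _ := by
        rw [ENNReal.tsum_mul_right, tsum_eq_sum (s := Finset.range J) fun q hq => if_neg fun h =>
          hq (Finset.mem_range.2 h)]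
        congr 1
        exact Finset.sum_congr rfl fun q hq => if_pos (Finset.mem_range.1 hq)

theorem inv_mul_inv_mul_inv_le {x y z : ℝ} (hx : 0 < x) (hy : 0 < y) (hz : 0 < z) :
    x⁻¹ * y⁻¹ * z⁻¹ ≤ x ^ (-(3/2) : ℝ) * y ^ (-(3/2) : ℝ) + y ^ (-(3/2) : ℝ) * z ^ (-(3/2) : ℝ)
      + x ^ (-(3/2) : ℝ) * z ^ (-(3/2) : ℝ) := by
  have key : ∀ w : ℝ, 0 < w → w ^ (-(3/2) : ℝ) = (√(w⁻¹)) ^ 3 := by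
    intro w hw
    rw [Real.sqrt_eq_rpow, ← Real.rpow_natCast, ← Real.rpow_mul (by positivity),
      Real.inv_rpow hw.le, ← Real.rpow_neg hw.le]
    norm_num
  have hsq : ∀ w : ℝ, 0 < w → w⁻¹ = √(w⁻¹) ^ 2 := fun w hw =>
    (Real.sq_sqrt (by positivity)).symm
  rw [key x hx, key y hy, key z hz, hsq x hx, hsq y hy, hsq z hz,
    Real.sqrt_sq (Real.sqrt_nonneg _), Real.sqrt_sq (Real.sqrt_nonneg _),
    Real.sqrt_sq (Real.sqrt_nonneg _)]
  have amgm : ∀ α β γ : ℝ, 0 ≤ α → 0 ≤ β → 0 ≤ γ → α * β * γ ≤ α ^ 3 + β ^ 3 + γ ^ 3 := by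
    intro α β γ ha hb hc
    nlinarith [mul_nonneg (add_nonneg (add_nonneg ha hb) hc) (add_nonneg (add_nonneg
      (sq_nonneg (α - β)) (sq_nonneg (β - γ))) (sq_nonneg (α - γ))),
      mul_nonneg (mul_nonneg ha hb) hc]
  set a := √(x⁻¹)
  set b := √(y⁻¹)
  set c := √(z⁻¹)
  have ha : 0 ≤ a := Real.sqrt_nonneg _
  have hb : 0 ≤ b := Real.sqrt_nonneg _
  have hc : 0 ≤ c := Real.sqrt_nonneg _
  have := amgm (a * b) (b * c) (a * c) (by positivity) (by positivity) (by positivity)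
  nlinarith

theorem ENNReal.exists_resonant_inv_sum_le : ∃ C : ℝ≥0∞, C ≠ ∞ ∧ ∀ j : ℕ,
    ∑' x : ℕ × ℕ × ℕ, (if x.1 + x.2.2 = x.2.1 + j then
      ENNReal.ofReal (((x.1 : ℝ) + 1)⁻¹ * ((x.2.1 : ℝ) + 1)⁻¹ * ((x.2.2 : ℝ) + 1)⁻¹) else 0)
      ≤ C := by
  set b : ℕ → ℝ≥0∞ := fun p => ENNReal.ofReal (((p : ℝ) + 1) ^ (-(3/2) : ℝ)) with hb
  have hbfin : ∑' p, b p ≠ ∞ := by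
    have hs : Summable fun p : ℕ => ((p : ℝ) + 1) ^ (-(3/2) : ℝ) := by
      have := (summable_nat_add_iff 1).2 (Real.summable_nat_rpow (p := -(3/2))|>.2 (by norm_num))
      simpa using this
    exact hs.tsum_ofReal_ne_top
  refine ⟨3 * (∑' p, b p) ^ 2, by finiteness, fun j => ?_⟩
  have hsq : ∑' p, ∑' q, b p * b q = (∑' p, b p) ^ 2 := by
    simp only [ENNReal.tsum_mul_left, ENNReal.tsum_mul_right, sq]
  calc _ ≤ ∑' x : ℕ × ℕ × ℕ, ((if x.1 + x.2.2 = x.2.1 + j then b x.1 * b x.2.1 else 0)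
          + (if x.1 + x.2.2 = x.2.1 + j then b x.2.1 * b x.2.2 else 0)
          + (if x.1 + x.2.2 = x.2.1 + j then b x.1 * b x.2.2 else 0)) := by
        gcongr with x
        split_ifs with h
        · simp only [hb]
          rw [← ENNReal.ofReal_mul (by positivity), ← ENNReal.ofReal_mul (by positivity),
            ← ENNReal.ofReal_mul (by positivity), ← ENNReal.ofReal_add (by positivity)
            (by positivity), ← ENNReal.ofReal_add (by positivity) (by positivity)]
          exact ENNReal.ofReal_le_ofReal
            (inv_mul_inv_mul_inv_le (by positivity) (by positivity) (by positivity))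
        · exact zero_le
    _ = ∑' p, ∑' q, ∑' r, (if p + r = q + j then b p * b q else 0)
        + ∑' q, ∑' r, ∑' p, (if p + r = q + j then b q * b r else 0)
        + ∑' p, ∑' r, ∑' q, (if p + r = q + j then b p * b r else 0) := by
        rw [ENNReal.tsum_add, ENNReal.tsum_add]
        congr 1
        · congr 1
          · rw [ENNReal.tsum_prod']
            exact tsum_congr fun p => ENNReal.tsum_prod'
          · rw [ENNReal.tsum_prod', ENNReal.tsum_comm, ENNReal.tsum_prod']
        · rw [ENNReal.tsum_prod']
          refine tsum_congr fun p => ?_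
          rw [ENNReal.tsum_prod', ENNReal.tsum_comm]
    _ ≤ ∑' p, ∑' q, b p * b q + ∑' p, ∑' q, b p * b q + ∑' p, ∑' q, b p * b q := by
        gcongr with p q q r p r
        · exact ENNReal.tsum_ite_le_of_unique _ _ fun i j hi hj => by omega
        · exact ENNReal.tsum_ite_le_of_unique _ _ fun i j hi hj => by omega
        · exact ENNReal.tsum_ite_le_of_unique _ _ fun i j hi hj => by omega
    _ = 3 * (∑' p, b p) ^ 2 := by rw [hsq]; ring

theorem ENNReal.exists_trilinear_bound : ∃ C : ℝ≥0∞, C ≠ ∞ ∧ ∀ (A G : ℕ → ℝ≥0∞) (k : ℕ),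
    ∑' ℓ, ∑' x : ℕ × ℕ × ℕ, (if x.1 + x.2.2 = x.2.1 + (k + ℓ) then
      A x.1 * A x.2.1 * A x.2.2 * G ℓ else 0)
      ≤ (∑' n : ℕ, ((n : ℝ≥0∞) + 1) * A n ^ 2) ^ 3 + C * ∑' ℓ, G ℓ ^ 2 := by
  obtain ⟨C, hC, hCj⟩ := ENNReal.exists_resonant_inv_sum_le
  refine ⟨C, hC, fun A G k => ?_⟩
  set Y : ℕ → ℝ≥0∞ := fun p => ENNReal.ofReal (√((p : ℝ) + 1)) with hY
  have hY2 : ∀ p : ℕ, Y p ^ 2 = (p : ℝ≥0∞) + 1 := by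
    intro p
    simp only [hY]
    rw [← ENNReal.ofReal_pow (by positivity), Real.sq_sqrt (by positivity),
      ENNReal.ofReal_add (by positivity) (by positivity)]
    simp
  have hYinv : ∀ p, Y p * (Y p)⁻¹ = 1 := fun p => ENNReal.mul_inv_cancel
    (by simp only [hY]; rw [Ne, ENNReal.ofReal_eq_zero, not_le]; positivity) ENNReal.ofReal_ne_top
  have hYinv2 : ∀ p : ℕ, (Y p)⁻¹ ^ 2 = ENNReal.ofReal (((p : ℝ) + 1)⁻¹) := by
    intro p
    rw [← ENNReal.inv_pow, hY2, ENNReal.ofReal_inv_of_pos (by positivity),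
      ENNReal.ofReal_add (by positivity) (by positivity)]
    simp
  have hpt : ∀ p q r ℓ, A p * A q * A r * G ℓ ≤
      ((Y p * A p) ^ 2 * ((Y q * A q) ^ 2 * (Y r * A r) ^ 2))
        + G ℓ ^ 2 * ENNReal.ofReal (((p : ℝ) + 1)⁻¹ * ((q : ℝ) + 1)⁻¹ * ((r : ℝ) + 1)⁻¹) := by
    intro p q r ℓ
    calc A p * A q * A r * G ℓ
        = (Y p * A p * ((Y q * A q) * (Y r * A r))) * (G ℓ * ((Y p)⁻¹ * (Y q)⁻¹ * (Y r)⁻¹)) := by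
          calc _ = A p * A q * A r * G ℓ * (Y p * (Y p)⁻¹) * (Y q * (Y q)⁻¹)
                * (Y r * (Y r)⁻¹) := by rw [hYinv, hYinv, hYinv]; simp
            _ = _ := by ring
      _ ≤ _ := ENNReal.mul_le_sq_add_sq _ _
      _ = _ := by
          rw [ENNReal.ofReal_mul (by positivity), ENNReal.ofReal_mul (by positivity), ← hYinv2,
            ← hYinv2, ← hYinv2]
          ring
  calc _ ≤ ∑' ℓ, ∑' x : ℕ × ℕ × ℕ, ((if x.1 + x.2.2 = x.2.1 + (k + ℓ) then
            (Y x.1 * A x.1) ^ 2 * ((Y x.2.1 * A x.2.1) ^ 2 * (Y x.2.2 * A x.2.2) ^ 2) else 0)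
          + G ℓ ^ 2 * (if x.1 + x.2.2 = x.2.1 + (k + ℓ) then ENNReal.ofReal
              (((x.1 : ℝ) + 1)⁻¹ * ((x.2.1 : ℝ) + 1)⁻¹ * ((x.2.2 : ℝ) + 1)⁻¹) else 0)) := by
        gcongr with ℓ x
        split_ifs with h
        · exact hpt _ _ _ _
        · exact zero_le
    _ = ∑' x : ℕ × ℕ × ℕ, ∑' ℓ, (if x.1 + x.2.2 = x.2.1 + (k + ℓ) then
            (Y x.1 * A x.1) ^ 2 * ((Y x.2.1 * A x.2.1) ^ 2 * (Y x.2.2 * A x.2.2) ^ 2) else 0)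
        + ∑' ℓ, G ℓ ^ 2 * ∑' x : ℕ × ℕ × ℕ, (if x.1 + x.2.2 = x.2.1 + (k + ℓ) then ENNReal.ofReal
              (((x.1 : ℝ) + 1)⁻¹ * ((x.2.1 : ℝ) + 1)⁻¹ * ((x.2.2 : ℝ) + 1)⁻¹) else 0) := by
        simp only [ENNReal.tsum_add, ENNReal.tsum_mul_left]
        rw [ENNReal.tsum_comm]
    _ ≤ ∑' x : ℕ × ℕ × ℕ,
            (Y x.1 * A x.1) ^ 2 * ((Y x.2.1 * A x.2.1) ^ 2 * (Y x.2.2 * A x.2.2) ^ 2)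
        + ∑' ℓ, G ℓ ^ 2 * C := by
        gcongr with x ℓ
        · exact ENNReal.tsum_ite_le_of_unique _ _ fun i j hi hj => by omega
        · exact hCj _
    _ = _ := by
        rw [ENNReal.tsum_mul_right, mul_comm C]
        congr 1
        simp only [ENNReal.tsum_prod', ENNReal.tsum_mul_left, ENNReal.tsum_mul_right, mul_pow, hY2]
        ring

theorem MemHs.summable_energy {s : ℝ} (hs : 1 / 2 < s) {u : ℕ → ℂ} (hu : MemHs s u) :
    Summable fun n : ℕ => ((n : ℝ) + 1) * ‖u n‖ ^ 2 := by
  refine Summable.of_nonneg_of_le (fun n => by positivity) (fun n => ?_) (hu.mul_left 2)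
  have h1 : (1 : ℝ) ≤ 1 + (n : ℝ) ^ 2 := by nlinarith [sq_nonneg (n : ℝ)]
  have h2 : √(1 + (n : ℝ) ^ 2) ≤ (1 + (n : ℝ) ^ 2) ^ s := by
    rw [Real.sqrt_eq_rpow]
    exact Real.rpow_le_rpow_of_exponent_le h1 hs.le
  have h3 : ((n : ℝ) + 1) / 2 ≤ √(1 + (n : ℝ) ^ 2) := by
    apply Real.le_sqrt_of_sq_le
    nlinarith [sq_nonneg ((n : ℝ) - 1), sq_nonneg (n : ℝ)]
  nlinarith [sq_nonneg ‖u n‖]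

theorem MemHs.summable_norm {s : ℝ} (hs : 1 / 2 < s) {u : ℕ → ℂ} (hu : MemHs s u) :
    Summable fun n : ℕ => ‖u n‖ := by
  have hw : Summable fun n : ℕ => ((1 : ℝ) + (n : ℝ) ^ 2) ^ (-s) := by
    refine (summable_nat_add_iff 1).1 ?_
    have h := (summable_nat_add_iff 1).2 (Real.summable_nat_rpow (p := -(2 * s))|>.2 (by linarith))
    refine Summable.of_nonneg_of_le (fun n => by positivity) (fun n => ?_) h
    push_cast
    have h0 : (0 : ℝ) < (n : ℝ) + 1 := by positivity
    rw [show -(2 * s) = 2 * (-s) by ring, Real.rpow_mul h0.le, Real.rpow_two]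
    exact Real.rpow_le_rpow_of_nonpos (by positivity) (by linarith) (by linarith)
  refine Summable.of_nonneg_of_le (fun n => norm_nonneg _) (fun n => ?_) (hu.add hw)
  have h0 : (0 : ℝ) < 1 + (n : ℝ) ^ 2 := by positivity
  rw [Real.rpow_neg h0.le]
  set x := (1 + (n : ℝ) ^ 2) ^ s
  have hx : 0 < x := Real.rpow_pos_of_pos h0 s
  have h1 : x * ‖u n‖ ^ 2 + x⁻¹ - ‖u n‖ = x⁻¹ * ((x * ‖u n‖ - 1 / 2) ^ 2 + 3 / 4) := by
    field_simp
    ring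
  have h2 : 0 ≤ x⁻¹ * ((x * ‖u n‖ - 1 / 2) ^ 2 + 3 / 4) := by positivity
  linarith

theorem summable_resonant {u g : ℕ → ℂ} (hu : Summable fun n => ‖u n‖) {B : ℝ}
    (hg : ∀ n, ‖g n‖ ≤ B) (k : ℕ) :
    Summable fun x : ℕ × ℕ × ℕ × ℕ => if x.2.1 + x.2.2.2 = x.2.2.1 + (k + x.1) then
      u x.2.1 * conj (u x.2.2.1) * u x.2.2.2 * g x.1 else 0 := by
  have h3 : Summable fun y : ℕ × ℕ × ℕ => ‖u y.1‖ * (‖u y.2.1‖ * ‖u y.2.2‖) :=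
    hu.mul_of_nonneg (hu.mul_of_nonneg hu (fun _ => norm_nonneg _) fun _ => norm_nonneg _)
      (fun _ => norm_nonneg _) fun _ => by positivity
  set S : Set (ℕ × ℕ × ℕ × ℕ) := {x | x.2.1 + x.2.2.2 = x.2.2.1 + (k + x.1)} with hS
  have hinj : Function.Injective fun x : S => (x : ℕ × ℕ × ℕ × ℕ).2 := by
    rintro ⟨⟨a, b⟩, h⟩ ⟨⟨a', b'⟩, h'⟩ (rfl : b = b')
    simp only [hS, Set.mem_ofPred_eq] at h h'
    have : a = a' := by omega
    subst this
    rfl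
  have hsub : Summable fun x : S =>
      u x.1.2.1 * conj (u x.1.2.2.1) * u x.1.2.2.2 * g x.1.1 := by
    refine Summable.of_norm_bounded ((h3.comp_injective hinj).mul_right B) fun x => ?_
    simp only [norm_mul, RCLike.norm_conj, Function.comp]
    rw [← mul_assoc]
    exact mul_le_mul_of_nonneg_left (hg _) (by positivity)
  refine ((summable_subtype_iff_indicator
    (f := fun x : ℕ × ℕ × ℕ × ℕ => u x.2.1 * conj (u x.2.2.1) * u x.2.2.2 * g x.1)).1
      hsub).congr fun x => ?_
  by_cases h : x ∈ S
  · rw [Set.indicator_of_mem h]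
    exact (if_pos h).symm
  · rw [Set.indicator_of_notMem h]
    exact (if_neg h).symm

/-- The summand of `∑ cubic u n * conj (u n)`. -/
def resonant (u : ℕ → ℂ) (x : ℕ × ℕ × ℕ × ℕ) : ℂ :=
  if x.2.1 + x.2.2.2 = x.2.2.1 + x.1 then
    u x.2.1 * conj (u x.2.2.1) * u x.2.2.2 * conj (u x.1) else 0

theorem sum_cubic_eq_tsum {u : ℕ → ℂ} (hu : Summable fun n => ‖u n‖) {w : ℕ → ℝ} {J : ℕ}
    (hw : ∀ n, J ≤ n → w n = 0) :
    (Summable fun x => (w x.1 : ℂ) * resonant u x) ∧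
    ∑ n ∈ Finset.range J, (w n : ℂ) * (cubic u n * conj (u n))
      = ∑' x, (w x.1 : ℂ) * resonant u x := by
  have hb : ∀ n, ‖(w n : ℂ) * conj (u n)‖ ≤ ∑ n ∈ Finset.range J, ‖(w n : ℂ) * conj (u n)‖ := by
    intro n
    by_cases hn : n < J
    · exact Finset.single_le_sum (f := fun n => ‖(w n : ℂ) * conj (u n)‖)
        (fun _ _ => norm_nonneg _) (Finset.mem_range.2 hn)
    · rw [hw n (not_lt.1 hn)]
      simp only [ofReal_zero, zero_mul, norm_zero]
      positivity
  have hs : Summable fun x => (w x.1 : ℂ) * resonant u x := by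
    refine (summable_resonant hu hb 0).congr fun x => ?_
    simp only [resonant, zero_add, mul_ite, mul_zero]
    split_ifs <;> ring
  refine ⟨hs, ?_⟩
  rw [hs.tsum_prod, tsum_eq_sum (s := Finset.range J)]
  · refine Finset.sum_congr rfl fun n _ => ?_
    dsimp only
    rw [tsum_mul_left, cubic, ← tsum_mul_right]
    congr 1
    refine tsum_congr fun q => ?_
    simp only [resonant, ite_mul, zero_mul]
  · intro n hn
    simp [hw n (by simpa using hn)]

theorem four_mul_abs_im_le {u : ℕ → ℂ} (hu : Summable fun n => ‖u n‖) {w : ℕ → ℝ} {J : ℕ}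
    (hw : ∀ n, J ≤ n → w n = 0) :
    ENNReal.ofReal (4 * |(∑ n ∈ Finset.range J, (w n : ℂ) * (cubic u n * conj (u n))).im|)
      ≤ ∑' x, ‖((w x.2.1 + w x.2.2.2 - w x.2.2.1 - w x.1 : ℝ) : ℂ) * resonant u x‖ₑ := by
  obtain ⟨hs, heq⟩ := sum_cubic_eq_tsum hu hw
  rw [heq]
  set T := ∑' x, (w x.1 : ℂ) * resonant u x with hT
  have h1 : HasSum (fun x => (w x.1 : ℂ) * resonant u x) T := hs.hasSum
  have h1' : HasSum (fun x => (w x.1 : ℂ) * conj (resonant u x)) (conj T) := by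
    simpa using Complex.hasSum_conj'.2 h1
  let e₁ : ℕ × ℕ × ℕ × ℕ ≃ ℕ × ℕ × ℕ × ℕ :=
    { toFun := fun x => (x.2.2.1, x.2.1, x.1, x.2.2.2)
      invFun := fun x => (x.2.2.1, x.2.1, x.1, x.2.2.2)
      left_inv := fun _ => rfl
      right_inv := fun _ => rfl }
  let e₂ : ℕ × ℕ × ℕ × ℕ ≃ ℕ × ℕ × ℕ × ℕ :=
    { toFun := fun x => (x.2.1, x.1, x.2.2.2, x.2.2.1)
      invFun := fun x => (x.2.1, x.1, x.2.2.2, x.2.2.1)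
      left_inv := fun _ => rfl
      right_inv := fun _ => rfl }
  let e₃ : ℕ × ℕ × ℕ × ℕ ≃ ℕ × ℕ × ℕ × ℕ :=
    { toFun := fun x => (x.2.2.2, x.1, x.2.1, x.2.2.1)
      invFun := fun x => (x.2.1, x.2.2.1, x.2.2.2, x.1)
      left_inv := fun _ => rfl
      right_inv := fun _ => rfl }
  have h2 : HasSum (fun x => (w x.2.2.1 : ℂ) * resonant u x) T := by
    rw [← e₁.hasSum_iff] at h1
    convert h1 using 2 with x
    simp only [e₁, resonant, Function.comp, Equiv.coe_fn_mk]
    split_ifs <;> first | omega | ring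
  have h3 : HasSum (fun x => (w x.2.1 : ℂ) * resonant u x) (conj T) := by
    rw [← e₂.hasSum_iff] at h1'
    convert h1' using 2 with x
    simp only [e₂, resonant, Function.comp, Equiv.coe_fn_mk]
    split_ifs <;> first | omega | (simp [mul_assoc, mul_comm, mul_left_comm])
  have h4 : HasSum (fun x => (w x.2.2.2 : ℂ) * resonant u x) (conj T) := by
    rw [← e₃.hasSum_iff] at h1'
    convert h1' using 2 with x
    simp only [e₃, resonant, Function.comp, Equiv.coe_fn_mk]
    split_ifs <;> first | omega | (simp [mul_assoc, mul_comm, mul_left_comm])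
  have h5 := ((h3.add h4).sub h2).sub h1
  have h6 : ‖conj T + conj T - T - T‖ = 4 * |T.im| := by
    have : conj T + conj T - T - T = ((-4 * T.im : ℝ) : ℂ) * Complex.I := by
      apply Complex.ext
      · simp
      · simp
        ring
    rw [this, norm_mul, Complex.norm_I, Complex.norm_real, Real.norm_eq_abs, abs_mul]
    norm_num
  rw [← h6, ofReal_norm, ← h5.tsum_eq]
  refine enorm_tsum_le_tsum_enorm.trans (le_of_eq (tsum_congr fun x => ?_))
  congr 1
  push_cast
  ring

theorem SolvesSzego.hasDerivAt_sum_normSq {α : ℝ} {u : ℝ → ℕ → ℂ} (hsol : SolvesSzego α u)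
    (w : ℕ → ℝ) (J : ℕ) (t : ℝ) :
    HasDerivAt (fun τ => ∑ n ∈ Finset.range J, w n * ‖u τ n‖ ^ 2)
      (2 * (∑ n ∈ Finset.range J, (w n : ℂ) * (cubic (u t) n * conj (u t n))).im) t := by
  rw [Complex.im_sum, Finset.mul_sum]
  refine HasDerivAt.fun_sum fun n _ => ?_
  refine (((hsol n t).norm_sq).const_mul (w n)).congr_deriv ?_
  rw [Complex.inner]
  simp only [oneSeq]
  split_ifs with h
  · subst h
    simp
    ring
  · simp
    ring

theorem logCutoff_natCast_eq_zero {L : ℝ} (hL : 0 < L) {n : ℕ} (hn : ⌊Real.exp L⌋₊ ≤ n) :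
    logCutoff L ((n : ℝ) + 1) = 0 := by
  refine logCutoff_eq_zero hL ((Nat.lt_floor_add_one _).le.trans ?_)
  gcongr

theorem enorm_second_difference_mul_le {L : ℝ} (hL : 0 < L) (A : ℕ → ℝ≥0∞) {p r n q : ℕ}
    (h : p + r = q + n) (hpn : p ≤ n) (hrn : r ≤ n) :
    ‖logCutoff L ((p : ℝ) + 1) + logCutoff L ((r : ℝ) + 1) - logCutoff L ((q : ℝ) + 1)
        - logCutoff L ((n : ℝ) + 1)‖ₑ * (A p * A r * A q * A n)
      ≤ ENNReal.ofReal (8 / L) *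
        (if p + r = q + n ∧ p ≤ n ∧ r ≤ n ∧ q < ⌊Real.exp L⌋₊ then
          (ENNReal.ofReal √((p : ℝ) + 1) * A p) * (ENNReal.ofReal √((r : ℝ) + 1) * A r)
            * A n * A q else 0) := by
  by_cases hq : q < ⌊Real.exp L⌋₊
  · rw [if_pos ⟨h, hpn, hrn, hq⟩]
    have hR : (p : ℝ) + r = q + n := by exact_mod_cast h
    have hb := abs_logCutoff_second_difference_le (p := (p : ℝ) + 1) (q := (q : ℝ) + 1)
      (r := (r : ℝ) + 1) (n := (n : ℝ) + 1) hL (by simp) (by simp) (by simp)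
      (by gcongr) (by gcongr) (by linarith)
    calc _ ≤ ENNReal.ofReal (8 / L * (√((p : ℝ) + 1) * √((r : ℝ) + 1)))
          * (A p * A r * A q * A n) := by
          gcongr
          rw [Real.enorm_eq_ofReal_abs]
          exact ENNReal.ofReal_le_ofReal hb
      _ = _ := by
          rw [ENNReal.ofReal_mul (by positivity), ENNReal.ofReal_mul (by positivity)]
          ring
  · rw [not_lt] at hq
    rw [logCutoff_natCast_eq_zero hL hq, logCutoff_natCast_eq_zero hL (n := p) (by omega),
      logCutoff_natCast_eq_zero hL (n := r) (by omega),
      logCutoff_natCast_eq_zero hL (n := n) (by omega)]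
    simp

theorem tsum_enorm_second_difference_le (u : ℕ → ℂ) {L : ℝ} (hL : 0 < L) :
    ∑' x : ℕ × ℕ × ℕ × ℕ, ‖((logCutoff L ((x.2.1 : ℝ) + 1) + logCutoff L ((x.2.2.2 : ℝ) + 1)
        - logCutoff L ((x.2.2.1 : ℝ) + 1) - logCutoff L ((x.1 : ℝ) + 1) : ℝ) : ℂ)
          * resonant u x‖ₑ
      ≤ ENNReal.ofReal (8 / L) * (4 * ((∑ q ∈ Finset.range ⌊Real.exp L⌋₊, ‖u q‖ₑ) *
        ((∑' n : ℕ, ((n : ℝ≥0∞) + 1) * ‖u n‖ₑ ^ 2) ^ 2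
          + ∑' n : ℕ, ((n : ℝ≥0∞) + 1) * ‖u n‖ₑ ^ 2))) := by
  set A : ℕ → ℝ≥0∞ := fun n => ‖u n‖ₑ with hA
  set D : ℕ → ℝ≥0∞ := fun p => ENNReal.ofReal √((p : ℝ) + 1) * A p with hD
  have hD2 : ∀ p : ℕ, D p ^ 2 = ((p : ℝ≥0∞) + 1) * A p ^ 2 := by
    intro p
    simp only [hD]
    rw [mul_pow, ← ENNReal.ofReal_pow (by positivity), Real.sq_sqrt (by positivity),
      ENNReal.ofReal_add (by positivity) (by positivity)]
    simp
  set J := ⌊Real.exp L⌋₊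
  set B : ℕ × ℕ × ℕ × ℕ → ℝ≥0∞ := fun x =>
    if x.1 + x.2.1 = x.2.2.2 + x.2.2.1 ∧ x.1 ≤ x.2.2.1 ∧ x.2.1 ≤ x.2.2.1 ∧ x.2.2.2 < J
        then D x.1 * D x.2.1 * A x.2.2.1 * A x.2.2.2 else 0 with hB
  have hsum := ENNReal.tsum_resonant_le A D J
  rw [tsum_congr hD2] at hsum
  set w : ℕ → ℝ := fun n => logCutoff L ((n : ℝ) + 1) with hw
  have key : ∀ p r n q : ℕ, p + r = q + n → p ≤ n → r ≤ n →
      ‖w p + w r - w q - w n‖ₑ * (A p * A r * A q * A n)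
        ≤ ENNReal.ofReal (8 / L) * B (p, r, n, q) := fun p r n q h h1 h2 =>
    enorm_second_difference_mul_le hL A h h1 h2
  have hpt : ∀ x : ℕ × ℕ × ℕ × ℕ,
      ‖((w x.2.1 + w x.2.2.2 - w x.2.2.1 - w x.1 : ℝ) : ℂ) * resonant u x‖ₑ
        ≤ ENNReal.ofReal (8 / L) * (B (x.2.1, x.2.2.2, x.1, x.2.2.1)
          + B (x.2.1, x.2.2.2, x.2.2.1, x.1) + B (x.2.2.1, x.1, x.2.1, x.2.2.2)
          + B (x.2.2.1, x.1, x.2.2.2, x.2.1)) := by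
    rintro ⟨n, p, q, r⟩
    simp only [resonant]
    split_ifs with h
    swap
    · simp
    have hnorm : ‖((w p + w r - w q - w n : ℝ) : ℂ) * (u p * conj (u q) * u r * conj (u n))‖ₑ
        = ‖w p + w r - w q - w n‖ₑ * (A p * A r * A q * A n) := by
      simp only [enorm_mul, RCLike.enorm_conj, hA]
      rw [show ‖((w p + w r - w q - w n : ℝ) : ℂ)‖ₑ = ‖w p + w r - w q - w n‖ₑ by
        rw [← ofReal_norm, ← ofReal_norm, Complex.norm_real]]
      ring
    have hneg : ‖w p + w r - w q - w n‖ₑ = ‖w q + w n - w p - w r‖ₑ := by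
      rw [← enorm_neg]
      congr 1
      ring
    rw [hnorm, mul_add, mul_add, mul_add]
    by_cases h1 : p ≤ n ∧ r ≤ n
    · exact (key p r n q h h1.1 h1.2).trans (le_add_right (le_add_right le_self_add))
    by_cases h2 : p ≤ q ∧ r ≤ q
    · refine le_add_right (le_add_right (le_add_left ?_))
      rw [show w p + w r - w q - w n = w p + w r - w n - w q by ring,
        show A p * A r * A q * A n = A p * A r * A n * A q by ring]
      exact key p r q n (by omega) h2.1 h2.2
    by_cases h3 : q ≤ p ∧ n ≤ p
    · refine le_add_right (le_add_left ?_)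
      rw [hneg, show w q + w n - w p - w r = w q + w n - w r - w p by ring,
        show A p * A r * A q * A n = A q * A n * A r * A p by ring]
      exact key q n p r (by omega) h3.1 h3.2
    · refine le_add_left ?_
      rw [hneg, show A p * A r * A q * A n = A q * A n * A p * A r by ring]
      exact key q n r p (by omega) (by omega) (by omega)
  let e₁ : ℕ × ℕ × ℕ × ℕ ≃ ℕ × ℕ × ℕ × ℕ :=
    { toFun := fun x => (x.2.1, x.2.2.2, x.1, x.2.2.1)
      invFun := fun y => (y.2.2.1, y.1, y.2.2.2, y.2.1)
      left_inv := fun _ => rfl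
      right_inv := fun _ => rfl }
  let e₂ : ℕ × ℕ × ℕ × ℕ ≃ ℕ × ℕ × ℕ × ℕ :=
    { toFun := fun x => (x.2.1, x.2.2.2, x.2.2.1, x.1)
      invFun := fun y => (y.2.2.2, y.1, y.2.2.1, y.2.1)
      left_inv := fun _ => rfl
      right_inv := fun _ => rfl }
  let e₃ : ℕ × ℕ × ℕ × ℕ ≃ ℕ × ℕ × ℕ × ℕ :=
    { toFun := fun x => (x.2.2.1, x.1, x.2.1, x.2.2.2)
      invFun := fun y => (y.2.1, y.2.2.1, y.1, y.2.2.2)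
      left_inv := fun _ => rfl
      right_inv := fun _ => rfl }
  let e₄ : ℕ × ℕ × ℕ × ℕ ≃ ℕ × ℕ × ℕ × ℕ :=
    { toFun := fun x => (x.2.2.1, x.1, x.2.2.2, x.2.1)
      invFun := fun y => (y.2.1, y.2.2.2, y.1, y.2.2.1)
      left_inv := fun _ => rfl
      right_inv := fun _ => rfl }
  refine (ENNReal.tsum_le_tsum hpt).trans ?_
  rw [ENNReal.tsum_mul_left, ENNReal.tsum_add, ENNReal.tsum_add, ENNReal.tsum_add]
  gcongr
  rw [show (4 : ℝ≥0∞) = 1 + 1 + 1 + 1 by norm_num, add_mul, add_mul, add_mul, one_mul]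
  exact add_le_add (add_le_add (add_le_add ((e₁.tsum_eq B).trans_le hsum)
    ((e₂.tsum_eq B).trans_le hsum)) ((e₃.tsum_eq B).trans_le hsum))
    ((e₄.tsum_eq B).trans_le hsum)

/-- The squared `H^{1/2}` norm, i.e. mass plus momentum. -/
def energy (u : ℕ → ℂ) : ℝ := ∑' n : ℕ, ((n : ℝ) + 1) * ‖u n‖ ^ 2

theorem energy_nonneg (u : ℕ → ℂ) : 0 ≤ energy u := tsum_nonneg fun n => by positivity

theorem ofReal_energy {u : ℕ → ℂ} (hE : Summable fun n : ℕ => ((n : ℝ) + 1) * ‖u n‖ ^ 2) :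
    ENNReal.ofReal (energy u) = ∑' n : ℕ, ((n : ℝ≥0∞) + 1) * ‖u n‖ₑ ^ 2 := by
  rw [energy, ENNReal.ofReal_tsum_of_nonneg (fun n => by positivity) hE]
  refine tsum_congr fun n => ?_
  rw [ENNReal.ofReal_mul (by positivity), ENNReal.ofReal_add (by positivity) (by positivity),
    ENNReal.ofReal_pow (norm_nonneg _), ofReal_norm]
  simp

theorem sum_norm_le_energy {u : ℕ → ℂ} (hE : Summable fun n : ℕ => ((n : ℝ) + 1) * ‖u n‖ ^ 2)
    {L M : ℝ} (hL : 0 < L) (hM : 0 < M) :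
    ∑ q ∈ Finset.range ⌊Real.exp L⌋₊, ‖u q‖ ≤ M * energy u + (1 + L) / M := by
  have hharm : ∑ q ∈ Finset.range ⌊Real.exp L⌋₊, ((q : ℝ) + 1)⁻¹ ≤ 1 + L := by
    have := harmonic_floor_le_one_add_log (Real.exp L) (Real.one_le_exp hL.le)
    rw [Real.log_exp] at this
    simpa [harmonic] using this
  calc ∑ q ∈ Finset.range ⌊Real.exp L⌋₊, ‖u q‖
      ≤ ∑ q ∈ Finset.range ⌊Real.exp L⌋₊,
          (M * (((q : ℝ) + 1) * ‖u q‖ ^ 2) + ((q : ℝ) + 1)⁻¹ / M) := by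
        gcongr with q
        have hx : (0 : ℝ) < (q : ℝ) + 1 := by positivity
        set x := (q : ℝ) + 1
        have h1 : M * (x * ‖u q‖ ^ 2) + x⁻¹ / M - ‖u q‖
            = (x⁻¹ / M) * ((M * x * ‖u q‖ - 1 / 2) ^ 2 + 3 / 4) := by
          field_simp
          ring
        have h2 : 0 ≤ (x⁻¹ / M) * ((M * x * ‖u q‖ - 1 / 2) ^ 2 + 3 / 4) := by positivity
        linarith
    _ ≤ M * energy u + (1 + L) / M := by
        rw [Finset.sum_add_distrib, ← Finset.mul_sum, ← Finset.sum_div]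
        gcongr
        exact hE.sum_le_tsum _ fun n _ => by positivity

theorem abs_flux_le {u : ℕ → ℂ} (hu : Summable fun n => ‖u n‖)
    (hE : Summable fun n : ℕ => ((n : ℝ) + 1) * ‖u n‖ ^ 2) {M : ℝ} (hM : 1 ≤ M) :
    |2 * (∑ n ∈ Finset.range ⌊Real.exp (M ^ 2)⌋₊, (logCutoff (M ^ 2) ((n : ℝ) + 1) : ℂ)
        * (cubic u n * conj (u n))).im| ≤ 16 / M * (energy u + 2) ^ 3 := by
  have hM0 : 0 < M := by linarith
  have hL : 0 < M ^ 2 := by positivity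
  have h1 := (four_mul_abs_im_le hu (w := fun n => logCutoff (M ^ 2) ((n : ℝ) + 1))
    (J := ⌊Real.exp (M ^ 2)⌋₊) fun n hn => logCutoff_natCast_eq_zero hL hn).trans
    (tsum_enorm_second_difference_le u hL)
  have h2 := sum_norm_le_energy hE hL hM0
  have hN := energy_nonneg u
  set a := ∑ q ∈ Finset.range ⌊Real.exp (M ^ 2)⌋₊, ‖u q‖ with ha
  have ha0 : 0 ≤ a := by positivity
  set N := energy u with hNdef
  have h3 : ∑ q ∈ Finset.range ⌊Real.exp (M ^ 2)⌋₊, ‖u q‖ₑ = ENNReal.ofReal a := by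
    rw [ha, ENNReal.ofReal_sum_of_nonneg fun _ _ => norm_nonneg _]
    simp only [ofReal_norm]
  rw [h3, ← ofReal_energy hE, ← hNdef, ← ENNReal.ofReal_pow hN, ← ENNReal.ofReal_add (by positivity) hN,
    ← ENNReal.ofReal_mul ha0, show (4 : ℝ≥0∞) = ENNReal.ofReal 4 by simp,
    ← ENNReal.ofReal_mul (by norm_num), ← ENNReal.ofReal_mul (by positivity),
    ENNReal.ofReal_le_ofReal_iff (by positivity)] at h1
  rw [abs_mul, abs_two]
  have h4 : a ≤ M * (N + 2) := by
    refine h2.trans ?_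
    have : (1 + M ^ 2) / M ≤ 2 * M := by
      rw [div_le_iff₀ hM0]
      nlinarith
    linarith
  have h5 : 8 / M ^ 2 * (4 * (a * (N ^ 2 + N))) ≤ 32 / M * (N + 2) ^ 3 := by
    calc 8 / M ^ 2 * (4 * (a * (N ^ 2 + N)))
        ≤ 8 / M ^ 2 * (4 * (M * (N + 2) * (N + 2) ^ 2)) := by
          gcongr
          nlinarith
      _ = 32 / M * (N + 2) ^ 3 := by field_simp; ring
  have h6 : 32 / M * (N + 2) ^ 3 = 2 * (16 / M * (N + 2) ^ 3) := by ring
  linarith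

theorem energy_eq_of_solvesSzego {α s : ℝ} (hs : 1 / 2 < s) {u : ℝ → ℕ → ℂ}
    (hreg : SmoothHsCurve s u) (hsol : SolvesSzego α u) (t₁ t₂ : ℝ) :
    energy (u t₁) = energy (u t₂) := by
  have hE := fun t => (hreg.1 t).summable_energy hs
  have hu := fun t => (hreg.1 t).summable_norm hs
  have hder := fun (m : ℕ) t => hsol.hasDerivAt_sum_normSq
    (fun n => logCutoff (((m : ℝ) + 1) ^ 2) ((n : ℝ) + 1)) ⌊Real.exp (((m : ℝ) + 1) ^ 2)⌋₊ t
  have hL : ∀ m : ℕ, (0 : ℝ) < ((m : ℝ) + 1) ^ 2 := fun m => by positivity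
  have hsum : ∀ (m : ℕ) t, ∑ n ∈ Finset.range ⌊Real.exp (((m : ℝ) + 1) ^ 2)⌋₊,
      logCutoff (((m : ℝ) + 1) ^ 2) ((n : ℝ) + 1) * ‖u t n‖ ^ 2
        = ∑' n : ℕ, logCutoff (((m : ℝ) + 1) ^ 2) ((n : ℝ) + 1) * ‖u t n‖ ^ 2 := by
    intro m t
    refine (tsum_eq_sum fun n hn => ?_).symm
    rw [logCutoff_natCast_eq_zero (hL m) (by simpa using hn), zero_mul]
  have hterm : ∀ (m n : ℕ) t, logCutoff (((m : ℝ) + 1) ^ 2) ((n : ℝ) + 1) * ‖u t n‖ ^ 2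
      ≤ ((n : ℝ) + 1) * ‖u t n‖ ^ 2 := fun m n t => by
    gcongr
    exact logCutoff_le (hL m) (by simp)
  have hterm0 : ∀ (m n : ℕ) t,
      0 ≤ logCutoff (((m : ℝ) + 1) ^ 2) ((n : ℝ) + 1) * ‖u t n‖ ^ 2 := fun m n t =>
    mul_nonneg (logCutoff_nonneg (hL m) (by positivity)) (by positivity)
  refine const_of_deriv_le_of_tendsto (N := fun t => energy (u t)) (Φ := fun x => (x + 2) ^ 3)
    (ε := fun m : ℕ => 16 / ((m : ℝ) + 1))
    (f := fun m t => ∑ n ∈ Finset.range ⌊Real.exp (((m : ℝ) + 1) ^ 2)⌋₊,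
      logCutoff (((m : ℝ) + 1) ^ 2) ((n : ℝ) + 1) * ‖u t n‖ ^ 2)
    ?_ (fun m => by positivity) ?_ (fun m t => (hder m t).differentiableAt) ?_ ?_ ?_ t₁ t₂
  · exact tendsto_const_nhds.div_atTop
      (tendsto_atTop_add_const_right _ _ tendsto_natCast_atTop_atTop)
  · intro x y hxy
    exact (Odd.strictMono_pow (by decide : Odd 3)).monotone (by linarith)
  · intro m t
    refine le_trans (Finset.sum_le_sum fun n _ => hterm m n t) ?_
    exact (hE t).sum_le_tsum _ fun n _ => by positivity
  · intro t
    simp only [hsum]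
    refine tendsto_tsum_of_dominated_convergence (hE t) (fun n => ?_) (.of_forall fun m n => ?_)
    · refine Tendsto.mul_const _ ((tendsto_logCutoff (by simp)).comp ?_)
      exact (tendsto_pow_atTop two_ne_zero).comp
        (tendsto_atTop_add_const_right _ _ tendsto_natCast_atTop_atTop)
    · rw [Real.norm_eq_abs, abs_of_nonneg (hterm0 m n t)]
      exact hterm m n t
  · intro m t
    rw [(hder m t).deriv]
    exact abs_flux_le (hu t) (hE t) (by simp)

theorem MemL2.exists_norm_le {h : ℕ → ℂ} (hh : MemL2 h) : ∃ B : ℝ, ∀ n, ‖h n‖ ≤ B := by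
  obtain ⟨B, hB⟩ := (Memℓp.of_exponent_ge hh le_top : Memℓp h ∞).bddAbove
  exact ⟨B, fun n => hB ⟨n, rfl⟩⟩

theorem MemL2.summable_sq {h : ℕ → ℂ} (hh : MemL2 h) : Summable fun n => ‖h n‖ ^ 2 := by
  have := hh.summable (by norm_num)
  simpa using this

/-- The summand of `∑ cubic u (k + ℓ) * conj (h ℓ)`, indexed by `(ℓ, p, q, r)`. -/
def hankelResonant (u h : ℕ → ℂ) (k : ℕ) (x : ℕ × ℕ × ℕ × ℕ) : ℂ :=
  if x.2.1 + x.2.2.2 = x.2.2.1 + (k + x.1) then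
    u x.2.1 * conj (u x.2.2.1) * u x.2.2.2 * conj (h x.1) else 0

theorem summable_hankelResonant {u h : ℕ → ℂ} (hu : Summable fun n => ‖u n‖)
    (hh : MemL2 h) (k : ℕ) :
    Summable (hankelResonant u h k) := by
  obtain ⟨B, hB⟩ := hh.exists_norm_le
  exact summable_resonant hu (g := fun n => conj (h n)) (fun n => by simpa using hB n) k

theorem hasSum_hankel_cubic {u h : ℕ → ℂ} (hu : Summable fun n => ‖u n‖)
    (hh : MemL2 h) (k : ℕ) :
    HasSum (fun ℓ => cubic u (k + ℓ) * conj (h ℓ)) (∑' x, hankelResonant u h k x) := by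
  have hs := summable_hankelResonant hu hh k
  have he : (fun ℓ => cubic u (k + ℓ) * conj (h ℓ))
      = fun ℓ => ∑' y, hankelResonant u h k (ℓ, y) := by
    funext ℓ
    rw [cubic, ← tsum_mul_right]
    exact tsum_congr fun y => by simp only [hankelResonant, ite_mul, zero_mul]
  rw [he, hs.tsum_prod]
  exact hs.prod.hasSum

theorem hasSum_prod_prod {β : Type*} {f : ℕ × ℕ × β → ℂ} (hf : Summable f) :
    HasSum (fun a => ∑' b, ∑' c, f (a, b, c)) (∑' x, f x) := by
  have : (fun a => ∑' b, ∑' c, f (a, b, c)) = fun a => ∑' y, f (a, y) :=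
    funext fun a => ((hf.prod_factor a).tsum_prod).symm
  rw [this, hf.tsum_prod]
  exact hf.prod.hasSum

theorem toeplitzAbsSq_hankel {u h : ℕ → ℂ} (hu : Summable fun n => ‖u n‖)
    (hh : MemL2 h) (k : ℕ) :
    toeplitzAbsSq u (hankel u h) k
      = ∑' x, {x : ℕ × ℕ × ℕ × ℕ | x.1 ≤ x.2.2.2}.indicator (hankelResonant u h k) x := by
  set S : Set (ℕ × ℕ × ℕ × ℕ) := {x | x.1 ≤ x.2.2.2} with hS
  have hs := (summable_hankelResonant hu hh k).indicator S
  let j : ℕ × ℕ × ℕ × ℕ → ℕ × ℕ × ℕ × ℕ := fun y => (y.2.1, y.2.2.1, y.2.2.2, y.1 + y.2.1)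
  have hj : Function.Injective j := by
    rintro ⟨a, b, c, d⟩ ⟨a', b', c', d'⟩ h
    simp only [j, Prod.mk.injEq] at h ⊢
    omega
  have hsupp : Function.support (S.indicator (hankelResonant u h k)) ⊆ Set.range j := by
    rintro ⟨ℓ, p, q, r⟩ hx
    have hmem : ((ℓ, p, q, r) : ℕ × ℕ × ℕ × ℕ) ∈ S := Set.mem_of_indicator_ne_zero hx
    have hle : ℓ ≤ r := hmem
    exact ⟨(r - ℓ, ℓ, p, q), by simp only [j, Prod.mk.injEq, true_and]; omega⟩
  rw [← hj.tsum_eq hsupp]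
  have hs' := hs.comp_injective hj
  refine Eq.trans ?_ (hasSum_prod_prod hs').tsum_eq
  rw [toeplitzAbsSq]
  refine tsum_congr fun m => ?_
  rw [hankel, ← tsum_mul_left]
  refine tsum_congr fun ℓ => ?_
  rw [absSqCoeff, ← tsum_mul_right]
  refine tsum_congr fun y => ?_
  simp only [j, Function.comp, hS]
  rw [Set.indicator_of_mem (by simp)]
  simp only [hankelResonant]
  split_ifs <;> first | omega | ring

theorem hasSum_hankel_toeplitzAbsSq {u h : ℕ → ℂ} (hu : Summable fun n => ‖u n‖)
    (hh : MemL2 h) (k : ℕ) :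
    HasSum (fun m => u (k + m) * conj (toeplitzAbsSq u h m))
      (∑' x, {x : ℕ × ℕ × ℕ × ℕ | k ≤ x.2.1}.indicator (hankelResonant u h k) x) := by
  set S : Set (ℕ × ℕ × ℕ × ℕ) := {x | k ≤ x.2.1} with hS
  have hs := (summable_hankelResonant hu hh k).indicator S
  let j : ℕ × ℕ × ℕ × ℕ → ℕ × ℕ × ℕ × ℕ := fun y => (y.2.1, k + y.1, y.2.2.1, y.2.2.2)
  have hj : Function.Injective j := by
    rintro ⟨a, b, c, d⟩ ⟨a', b', c', d'⟩ h
    simp only [j, Prod.mk.injEq] at h ⊢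
    omega
  have hsupp : Function.support (S.indicator (hankelResonant u h k)) ⊆ Set.range j := by
    rintro ⟨ℓ, p, q, r⟩ hx
    have hmem : ((ℓ, p, q, r) : ℕ × ℕ × ℕ × ℕ) ∈ S := Set.mem_of_indicator_ne_zero hx
    have hle : k ≤ p := hmem
    exact ⟨(p - k, ℓ, q, r), by simp only [j, Prod.mk.injEq, and_true, true_and]; omega⟩
  rw [← hj.tsum_eq hsupp]
  have hs' := hs.comp_injective hj
  convert hasSum_prod_prod hs' using 2 with m
  rw [toeplitzAbsSq, Complex.conj_tsum, ← tsum_mul_left]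
  refine tsum_congr fun ℓ => ?_
  rw [map_mul, absSqCoeff, Complex.conj_tsum, ← tsum_mul_right, ← tsum_mul_left]
  refine tsum_congr fun y => ?_
  simp only [j, Function.comp, hS]
  rw [Set.indicator_of_mem (by simp)]
  simp only [hankelResonant]
  split_ifs
  all_goals first
    | omega
    | (simp only [map_mul, conj_conj, map_zero]; ring)
    | simp

theorem hasSum_hankel_hu2 {u h : ℕ → ℂ} (hu : Summable fun n => ‖u n‖)
    (hh : MemL2 h) (k : ℕ) :
    HasSum (fun m => u (k + m) * conj (hu2 u h m))
      (∑' x, {x : ℕ × ℕ × ℕ × ℕ | x.1 ≤ x.2.2.2 ∧ k ≤ x.2.1}.indicator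
        (hankelResonant u h k) x) := by
  set S : Set (ℕ × ℕ × ℕ × ℕ) := {x | x.1 ≤ x.2.2.2 ∧ k ≤ x.2.1} with hS
  have hs := (summable_hankelResonant hu hh k).indicator S
  let j : ℕ × ℕ × ℕ → ℕ × ℕ × ℕ × ℕ := fun y => (y.2.2, k + y.1, y.1 + y.2.1, y.2.1 + y.2.2)
  have hj : Function.Injective j := by
    rintro ⟨a, b, c⟩ ⟨a', b', c'⟩ h
    simp only [j, Prod.mk.injEq] at h ⊢
    omega
  have hsupp : Function.support (S.indicator (hankelResonant u h k)) ⊆ Set.range j := by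
    rintro ⟨ℓ, p, q, r⟩ hx
    have hmem : ((ℓ, p, q, r) : ℕ × ℕ × ℕ × ℕ) ∈ S := Set.mem_of_indicator_ne_zero hx
    have hle : ℓ ≤ r ∧ k ≤ p := hmem
    rw [Function.mem_support, Set.indicator_of_mem hmem] at hx
    simp only [hankelResonant] at hx
    have hres : p + r = q + (k + ℓ) := by
      by_contra hne
      exact hx (if_neg hne)
    refine ⟨(p - k, r - ℓ, ℓ), ?_⟩
    simp only [j, Prod.mk.injEq, true_and]
    omega
  rw [← hj.tsum_eq hsupp]
  have hs' := hs.comp_injective hj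
  convert hasSum_prod_prod hs' using 2 with m
  swap
  · rfl
  rw [hu2, hankel, Complex.conj_tsum, ← tsum_mul_left]
  refine tsum_congr fun i => ?_
  rw [map_mul, conj_conj, hankel, ← tsum_mul_left, ← tsum_mul_left]
  refine tsum_congr fun ℓ => ?_
  simp only [j, Function.comp, hS]
  rw [Set.indicator_of_mem (by simp)]
  simp only [hankelResonant]
  rw [if_pos (by omega)]
  ring

/-- The Lax pair identity `-i H_{Π(|u|²u)} = [B_u, H_u]`. -/
theorem Bop_commutator {u h : ℕ → ℂ} (hu : Summable fun n => ‖u n‖)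
    (hh : MemL2 h) (k : ℕ) :
    Bop u (hankel u h) k - hankel u (Bop u h) k
      = -Complex.I * ∑' x, hankelResonant u h k x := by
  have hs := summable_hankelResonant hu hh k
  have hT := toeplitzAbsSq_hankel hu hh k
  have hHT := hasSum_hankel_toeplitzAbsSq hu hh k
  have hH3 := hasSum_hankel_hu2 hu hh k
  have hHB := (hH3.mul_left (-(Complex.I / 2))).add (hHT.mul_left Complex.I)
  have hHB' : hankel u (Bop u h) k = -(I / 2) * ∑' x, {x : ℕ × ℕ × ℕ × ℕ | x.1 ≤ x.2.2.2 ∧ k ≤ x.2.1}.indicator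
          (hankelResonant u h k) x
        + I * ∑' x, {x : ℕ × ℕ × ℕ × ℕ | k ≤ x.2.1}.indicator (hankelResonant u h k) x := by
    rw [← hHB.tsum_eq, hankel]
    refine tsum_congr fun m => ?_
    simp only [Bop, map_sub, map_mul, map_div₀, conj_I, map_ofNat]
    ring
  have hH3' : hu2 u (hankel u h) k
      = ∑' x, {x : ℕ × ℕ × ℕ × ℕ | x.1 ≤ x.2.2.2 ∧ k ≤ x.2.1}.indicator
          (hankelResonant u h k) x := hH3.tsum_eq
  rw [hHB', Bop, hH3', hT]
  have hsplit : ∑' x, hankelResonant u h k x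
      = ∑' x, {x : ℕ × ℕ × ℕ × ℕ | x.1 ≤ x.2.2.2}.indicator (hankelResonant u h k) x
        + ∑' x, {x : ℕ × ℕ × ℕ × ℕ | k ≤ x.2.1}.indicator (hankelResonant u h k) x
        - ∑' x, {x : ℕ × ℕ × ℕ × ℕ | x.1 ≤ x.2.2.2 ∧ k ≤ x.2.1}.indicator
          (hankelResonant u h k) x := by
    rw [← (hs.indicator _).tsum_add (hs.indicator _),
      ← ((hs.indicator _).add (hs.indicator _)).tsum_sub (hs.indicator _)]
    refine tsum_congr fun x => ?_
    simp only [Set.indicator, Set.mem_ofPred_eq]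
    by_cases h1 : x.1 ≤ x.2.2.2 <;> by_cases h2 : k ≤ x.2.1
    · simp [h1, h2]
    · simp [h1, h2]
    · simp [h1, h2]
    · rw [hankelResonant, if_neg (by omega)]
      simp
  rw [hsplit]
  ring

theorem tendstoUniformly_hankel_cubic {ι : Type*} {v : ι → ℕ → ℂ} {N : ℝ≥0∞} (hN : N ≠ ∞)
    (hv : ∀ i, Summable fun n => ‖v i n‖)
    (hvN : ∀ i, ∑' n : ℕ, ((n : ℝ≥0∞) + 1) * ‖v i n‖ₑ ^ 2 ≤ N) {h : ℕ → ℂ} (hh : MemL2 h) (k : ℕ) :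
    TendstoUniformly (fun m i => ∑ ℓ ∈ Finset.range m, cubic (v i) (k + ℓ) * conj (h ℓ))
      (fun i => ∑' ℓ, cubic (v i) (k + ℓ) * conj (h ℓ)) atTop := by
  obtain ⟨C, hC, htri⟩ := ENNReal.exists_trilinear_bound
  rw [EMetric.tendstoUniformly_iff]
  intro ε hε
  wlog hεtop : ε ≠ ∞ generalizing ε
  · filter_upwards [this 1 one_pos ENNReal.one_ne_top] with m hm i
    exact (hm i).trans_le (by rw [not_not.1 hεtop]; exact le_top)
  set c : ℝ≥0∞ := 2 * (N ^ 3 + 1) / ε with hc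
  have hctop : c ≠ ∞ := ENNReal.div_ne_top (by finiteness) hε.ne'
  have hc0 : c ≠ 0 := ENNReal.div_ne_zero.2 ⟨by simp, hεtop⟩
  have hsq : ∑' ℓ, ‖h ℓ‖ₑ ^ 2 ≠ ∞ := by
    have := hh.summable_sq.tsum_ofReal_ne_top
    simpa only [ENNReal.ofReal_pow (norm_nonneg _), ofReal_norm] using this
  have htail : Tendsto (fun m => C * (c ^ 2 * ∑' ℓ, ‖h (ℓ + m)‖ₑ ^ 2)) atTop (𝓝 0) := by
    have h1 := ENNReal.tendsto_sum_nat_add (fun ℓ => ‖h ℓ‖ₑ ^ 2) hsq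
    have h2 := ENNReal.Tendsto.const_mul (a := C) (ENNReal.Tendsto.const_mul (a := c ^ 2) h1
      (Or.inr (by finiteness))) (Or.inr hC)
    simpa using h2
  filter_upwards [htail.eventually (gt_mem_nhds one_pos)] with m hm i
  have hsum := (hasSum_hankel_cubic (hv i) hh k).summable
  have hsub : ∑' ℓ, cubic (v i) (k + ℓ) * conj (h ℓ)
      - ∑ ℓ ∈ Finset.range m, cubic (v i) (k + ℓ) * conj (h ℓ)
      = ∑' ℓ, cubic (v i) (k + (ℓ + m)) * conj (h (ℓ + m)) := by
    rw [← hsum.sum_add_tsum_nat_add m, add_sub_cancel_left]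
  rw [edist_eq_enorm_sub, hsub]
  set X := ∑' ℓ, ∑' x : ℕ × ℕ × ℕ, (if x.1 + x.2.2 = x.2.1 + (k + m + ℓ) then
    ‖v i x.1‖ₑ * ‖v i x.2.1‖ₑ * ‖v i x.2.2‖ₑ * ‖h (ℓ + m)‖ₑ else 0) with hX
  have hle : ‖∑' ℓ, cubic (v i) (k + (ℓ + m)) * conj (h (ℓ + m))‖ₑ ≤ X := by
    refine enorm_tsum_le_tsum_enorm.trans (ENNReal.tsum_le_tsum fun ℓ => ?_)
    rw [cubic, ← tsum_mul_right]
    refine enorm_tsum_le_tsum_enorm.trans (ENNReal.tsum_le_tsum fun x => ?_)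
    rw [show k + (ℓ + m) = k + m + ℓ by ring]
    split_ifs
    · simp only [enorm_mul, RCLike.enorm_conj, le_refl]
    · simp
  have hcX : c * X ≤ N ^ 3 + 1 := by
    have h1 := htri (fun n => ‖v i n‖ₑ) (fun ℓ => c * ‖h (ℓ + m)‖ₑ) (k + m)
    have h2 : c * X = ∑' ℓ, ∑' x : ℕ × ℕ × ℕ, (if x.1 + x.2.2 = x.2.1 + (k + m + ℓ) then
        ‖v i x.1‖ₑ * ‖v i x.2.1‖ₑ * ‖v i x.2.2‖ₑ * (c * ‖h (ℓ + m)‖ₑ) else 0) := by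
      rw [hX, ← ENNReal.tsum_mul_left]
      refine tsum_congr fun ℓ => ?_
      rw [← ENNReal.tsum_mul_left]
      refine tsum_congr fun x => ?_
      rw [mul_ite, mul_zero]
      congr 1
      ring
    rw [h2]
    refine h1.trans ?_
    gcongr
    · exact hvN i
    · simp only [mul_pow, ENNReal.tsum_mul_left]
      exact hm.le
  have hhalf : X ≤ ε / 2 := by
    have h3 : ε / 2 * c = N ^ 3 + 1 := by
      calc ε / 2 * c = ε * ε⁻¹ * (2 * 2⁻¹) * (N ^ 3 + 1) := by
            rw [hc, div_eq_mul_inv, div_eq_mul_inv]; ring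
        _ = N ^ 3 + 1 := by
            rw [ENNReal.mul_inv_cancel hε.ne' hεtop,
              ENNReal.mul_inv_cancel two_ne_zero ENNReal.ofNat_ne_top, one_mul, one_mul]
    rw [← h3, mul_comm] at hcX
    exact (ENNReal.mul_le_mul_iff_left hc0 hctop).1 hcX
  exact (hle.trans hhalf).trans_lt (ENNReal.half_lt_self hε.ne' hεtop)

/-- Along any solution of the α-Szegő equation,
`d/dt H_{u(t)} = [B_{u(t)}, H_{u(t)}] − i α (u(t)|1) H_1`. -/
theorem alphaSzego_hankel_evolution (α s : ℝ) (hs : 1/2 < s) (u : ℝ → ℕ → ℂ)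
    (hreg : SmoothHsCurve s u) (hsol : SolvesSzego α u) :
    ∀ h : ℕ → ℂ, MemL2 h → ∀ t k, HasDerivAt (fun τ => hankel (u τ) h k)
      (Bop (u t) (hankel (u t) h) k - hankel (u t) (Bop (u t) h) k
        - Complex.I * (α : ℂ) * u t 0 * hankel oneSeq h k) t := by
  intro h hh t k
  have hu := fun τ => (hreg.1 τ).summable_norm hs
  have hE := fun τ => (hreg.1 τ).summable_energy hs
  obtain ⟨B, hB⟩ := hh.exists_norm_le
  have hsumm : ∀ τ, Summable fun ℓ => u τ (k + ℓ) * conj (h ℓ) := fun τ => by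
    refine Summable.of_norm_bounded
      (((hu τ).comp_injective (add_right_injective k)).mul_right B) fun ℓ => ?_
    rw [norm_mul, RCLike.norm_conj]
    exact mul_le_mul_of_nonneg_left (hB ℓ) (norm_nonneg _)
  have hunif := tendstoUniformly_hankel_cubic (v := u) (N := ENNReal.ofReal (energy (u t)))
    ENNReal.ofReal_ne_top hu (fun τ => by
      rw [← ofReal_energy (hE τ), energy_eq_of_solvesSzego hs hreg hsol τ t]) hh k
  rw [Bop_commutator (hu t) hh k, ← (hasSum_hankel_cubic (hu t) hh k).tsum_eq]
  have hone : ∀ m, 1 ≤ m →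
      ∑ ℓ ∈ Finset.range m, oneSeq (k + ℓ) * conj (h ℓ) = hankel oneSeq h k := fun m hm => by
    refine (tsum_eq_sum fun ℓ hℓ => ?_).symm
    have : m ≤ ℓ := by simpa using hℓ
    rw [oneSeq, if_neg (by omega), zero_mul]
  have hder := hasDerivAt_of_tendstoUniformly (l := atTop)
    (f := fun m τ => ∑ ℓ ∈ Finset.range m, u τ (k + ℓ) * conj (h ℓ))
    (f' := fun m τ => -Complex.I * ∑ ℓ ∈ Finset.range m, cubic (u τ) (k + ℓ) * conj (h ℓ)
      - Complex.I * α * u τ 0 * hankel oneSeq h k)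
    (g := fun τ => hankel (u τ) h k)
    (g' := fun τ => -Complex.I * ∑' ℓ, cubic (u τ) (k + ℓ) * conj (h ℓ)
      - Complex.I * α * u τ 0 * hankel oneSeq h k) ?_ ?_
    (fun τ => (hsumm τ).hasSum.tendsto_sum_nat) t
  · exact hder
  · rw [Metric.tendstoUniformly_iff] at hunif ⊢
    intro ε hε
    filter_upwards [hunif ε hε] with m hm τ
    rw [dist_sub_right, dist_eq_norm, ← mul_sub, norm_mul, norm_neg, norm_I, one_mul,
      ← dist_eq_norm]
    exact hm τ
  · filter_upwards [eventually_ge_atTop 1] with m hm τ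
    refine (HasDerivAt.fun_sum fun ℓ _ =>
      (hsol (k + ℓ) τ).mul_const (conj (h ℓ))).congr_deriv ?_
    rw [← hone m hm, Finset.mul_sum, Finset.mul_sum, ← Finset.sum_sub_distrib]
    exact Finset.sum_congr rfl fun ℓ _ => by ring

end
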